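/- arXiv:2001.07541 — 2 statements merged into one kernel-verified Lean document; each statement's English description precedes it below -/
import Mathlib

section
/- Let O be an annotated ELH^r ontology in normal form and a₀ ∈ Ind(O). There exist a model I of T and an element ε ∈ Δ^I such that: (1) for every a ∈ N_I, a^I = ε iff there is no directed path of role assertions (R₀(a₀,a₁),v₀), …, (Rₙ(aₙ,a),vₙ) from a₀ to a in O; (2) for every a ∈ Ind(O), C_a^I = {(a^I, 1^I)} if a^I ≠ ε, and C_a^I = ∅ otherwise; (3) for every (R(a,b),v) ∈ O, R_{ab}^I = {(a^I, b^I, 1^I)} if a^I ≠ ε and b^I ≠ ε, and R_{ab}^I = ∅ otherwise; (4) for every a ∈ Ind(O) and every A ∈ N_C, if (a^I, m^I) ∈ A^I then T ⊨ (C_a ⊑ A, m) or T ⊨ (⊤ ⊑ A, m). -/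
/- Common framework: provenance-annotated ELH^r.
   Monomials are modelled as finite sets of provenance variables
   (monomials modulo commutativity, associativity and ×-idempotency;
   the representative [m] of a monomial is then the monomial itself,
   the product is union, and 1 is the empty set). -/

namespace Prov

abbrev Monomial (V : Type) := Finset V

/-- ELH^r concepts: C ::= A | ∃R.C | C ⊓ C | ⊤.  `∃R` is `ex R top`. -/
inductive Concept (C R : Type) : Type
  | top : Concept C R
  | atom : C → Concept C R
  | conj : Concept C R → Concept C R → Concept C R
  | ex : R → Concept C R → Concept C R

namespace Concept
variable {C R : Type}

/-- member of N_C ∪ {⊤} -/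
def IsBasic : Concept C R → Prop
  | top => True
  | atom _ => True
  | conj _ _ => False
  | ex _ _ => False

def cnames : Concept C R → Set C
  | top => ∅
  | atom A => {A}
  | conj c d => c.cnames ∪ d.cnames
  | ex _ c => c.cnames

def rnames : Concept C R → Set R
  | top => ∅
  | atom _ => ∅
  | conj c d => c.rnames ∪ d.rnames
  | ex r c => insert r c.rnames

def hasTop : Concept C R → Prop
  | top => True
  | atom _ => False
  | conj c d => c.hasTop ∨ d.hasTop
  | ex _ c => c.hasTop

/-- number of occurrences of concept and role names -/
def nameCount : Concept C R → ℕ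
  | top => 0
  | atom _ => 1
  | conj c d => c.nameCount + d.nameCount
  | ex _ c => 1 + c.nameCount

end Concept

/-- Axioms: GCIs, role inclusions, range restrictions, and assertions.
    (Assertions `ca` are allowed with an arbitrary concept so that
    instance queries C(a) and the auxiliary assertions ⊤(a) used by the
    completion algorithm are expressible; ELH^r assertions use a
    concept name.) -/
inductive Ax (C R Iv : Type) : Type
  | gci : Concept C R → Concept C R → Ax C R Iv
  | ri : R → R → Ax C R Iv
  | rr : R → C → Ax C R Iv
  | ca : Concept C R → Iv → Ax C R Iv
  | ra : R → Iv → Iv → Ax C R Iv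

namespace Ax
variable {C R Iv : Type}

def IsELHr : Ax C R Iv → Prop
  | gci _ d => (∃ A, d = Concept.atom A) ∨ (∃ r, d = Concept.ex r Concept.top)
  | ca c _ => ∃ A, c = Concept.atom A
  | _ => True

/-- normal form: GCIs of the form A ⊑ B, A ⊓ A' ⊑ B, A ⊑ ∃R, ∃R.A ⊑ B
    with A, A' ∈ N_C ∪ {⊤}, B ∈ N_C. -/
def IsNF : Ax C R Iv → Prop
  | gci c d =>
      ((∃ B, d = Concept.atom B) ∧
        (c.IsBasic ∨ (∃ a a', c = Concept.conj a a' ∧ a.IsBasic ∧ a'.IsBasic) ∨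
          (∃ r a, c = Concept.ex r a ∧ a.IsBasic)))
      ∨ (c.IsBasic ∧ ∃ r, d = Concept.ex r Concept.top)
  | ca c _ => ∃ A, c = Concept.atom A
  | _ => True

def IsAssertion : Ax C R Iv → Prop
  | ca _ _ => True
  | ra _ _ _ => True
  | _ => False

def cnames : Ax C R Iv → Set C
  | gci c d => c.cnames ∪ d.cnames
  | ri _ _ => ∅
  | rr _ A => {A}
  | ca c _ => c.cnames
  | ra _ _ _ => ∅

def rnames : Ax C R Iv → Set R
  | gci c d => c.rnames ∪ d.rnames
  | ri r s => {r, s}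
  | rr r _ => {r}
  | ca c _ => c.rnames
  | ra r _ _ => {r}

def inds : Ax C R Iv → Set Iv
  | ca _ a => {a}
  | ra _ a b => {a, b}
  | _ => ∅

def hasTop : Ax C R Iv → Prop
  | gci c d => c.hasTop ∨ d.hasTop
  | ca c _ => c.hasTop
  | _ => False

def nameCount : Ax C R Iv → ℕ
  | gci c d => c.nameCount + d.nameCount
  | ri _ _ => 2
  | rr _ _ => 2
  | ca c _ => c.nameCount + 1
  | ra _ _ _ => 3

end Ax

/-- annotated axiom -/
abbrev AnnAx (C R Iv V : Type) := Ax C R Iv × Monomial V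

/-- a (not necessarily well-formed) set of annotated axioms -/
abbrev Ont (C R Iv V : Type) := Set (AnnAx C R Iv V)

namespace Ont
variable {C R Iv V : Type}
def cnames (O : Ont C R Iv V) : Set C := {A | ∃ p ∈ O, A ∈ p.1.cnames}
def rnames (O : Ont C R Iv V) : Set R := {r | ∃ p ∈ O, r ∈ p.1.rnames}
def inds (O : Ont C R Iv V) : Set Iv := {a | ∃ p ∈ O, a ∈ p.1.inds}
def vars (O : Ont C R Iv V) : Set V := {v | ∃ p ∈ O, v ∈ p.2}
def hasTop (O : Ont C R Iv V) : Prop := ∃ p ∈ O, p.1.hasTop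
end Ont

/-- annotated ELH^r ontology: a finite set of annotated ELH^r axioms whose
    annotations are provenance variables or 1 (i.e. monomials of ≤ 1 variable) -/
def IsOntology {C R Iv V : Type} (O : Ont C R Iv V) : Prop :=
  O.Finite ∧ ∀ p ∈ O, p.1.IsELHr ∧ p.2.card ≤ 1

def IsNFOnt {C R Iv V : Type} (O : Ont C R Iv V) : Prop :=
  IsOntology O ∧ ∀ p ∈ O, p.1.IsNF

/-- Annotated interpretations.  `monI_inj` captures m^I = n^I iff [m] = [n]. -/
structure Interp (C R Iv V : Type) (Δ Δm : Type) where
  indI : Iv → Δ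
  conI : C → Set (Δ × Δm)
  rolI : R → Set (Δ × Δ × Δm)
  monI : Monomial V → Δm
  monI_inj : Function.Injective monI
  neD : Nonempty Δ
  neDm : Nonempty Δm

namespace Interp
variable {C R Iv V : Type} [DecidableEq V] {Δ Δm : Type}

/-- interpretation of complex concepts -/
def cInt (I : Interp C R Iv V Δ Δm) : Concept C R → Set (Δ × Δm)
  | Concept.top => {p | p.2 = I.monI ∅}
  | Concept.atom A => I.conI A
  | Concept.conj c d =>
      {p | ∃ x m n, (x, I.monI m) ∈ I.cInt c ∧ (x, I.monI n) ∈ I.cInt d ∧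
            p = (x, I.monI (m ∪ n))}
  | Concept.ex r c =>
      {p | ∃ x e m n, (x, e, I.monI m) ∈ I.rolI r ∧ (e, I.monI n) ∈ I.cInt c ∧
            p = (x, I.monI (m ∪ n))}

/-- interpretation of ran(R) -/
def ranI (I : Interp C R Iv V Δ Δm) (r : R) : Set (Δ × Δm) :=
  {p | ∃ d, (d, p.1, p.2) ∈ I.rolI r}

/-- satisfaction of an annotated axiom -/
def Sat (I : Interp C R Iv V Δ Δm) : Ax C R Iv → Monomial V → Prop
  | Ax.gci c d, m => ∀ x n, (x, I.monI n) ∈ I.cInt c → (x, I.monI (m ∪ n)) ∈ I.cInt d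
  | Ax.ri r s, m => ∀ x y n, (x, y, I.monI n) ∈ I.rolI r → (x, y, I.monI (m ∪ n)) ∈ I.rolI s
  | Ax.rr r A, m => ∀ x n, (x, I.monI n) ∈ I.ranI r → (x, I.monI (m ∪ n)) ∈ I.conI A
  | Ax.ca c a, m => (I.indI a, I.monI m) ∈ I.cInt c
  | Ax.ra r a b, m => (I.indI a, I.indI b, I.monI m) ∈ I.rolI r

def IsModel (I : Interp C R Iv V Δ Δm) (O : Ont C R Iv V) : Prop :=
  ∀ p ∈ O, I.Sat p.1 p.2

end Interp

/-- O ⊨ (α, m) -/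
def Entails {C R Iv V : Type} [DecidableEq V] (O : Ont C R Iv V) (α : Ax C R Iv)
    (m : Monomial V) : Prop :=
  ∀ (Δ Δm : Type) (I : Interp C R Iv V Δ Δm), I.IsModel O → I.Sat α m

end Prov

namespace Prov

variable {C R Iv V : Type} [DecidableEq V]

/-- The ontology T = ⋃_{a ∈ Ind(O)} T_{C_a} ∪ (O minus its assertions),
    built with fresh concept names C_a = cA a, C_{ran(R)} = cRan R and
    fresh role names R_{ab} = rab a b. -/
def Tont (O : Ont C R Iv V) (cA : Iv → C) (cRan : R → C) (rab : Iv → Iv → R) :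
    Ont C R Iv V :=
  {p | ∃ a A v, a ∈ Ont.inds O ∧ (Ax.ca (Concept.atom A) a, v) ∈ O ∧
        p = (Ax.gci (Concept.atom (cA a)) (Concept.atom A), v)} ∪
  {p | ∃ a b r v, a ∈ Ont.inds O ∧ (Ax.ra r a b, v) ∈ O ∧
        (p = (Ax.gci (Concept.atom (cA a)) (Concept.ex (rab a b) Concept.top),
              (∅ : Monomial V)) ∨
         p = (Ax.ri (rab a b) r, v) ∨
         p = (Ax.rr (rab a b) (cA b), (∅ : Monomial V)))} ∪
  {p | ∃ a b r v, a ∈ Ont.inds O ∧ (Ax.ra r b a, v) ∈ O ∧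
        p = (Ax.gci (Concept.atom (cA a)) (Concept.atom (cRan r)), v)} ∪
  {p | ∃ a r s v, a ∈ Ont.inds O ∧ (Ax.ri r s, v) ∈ O ∧
        p = (Ax.gci (Concept.atom (cRan r)) (Concept.atom (cRan s)), v)} ∪
  {p | ∃ a r A v, a ∈ Ont.inds O ∧ (Ax.rr r A, v) ∈ O ∧
        p = (Ax.gci (Concept.atom (cRan r)) (Concept.atom A), v)} ∪
  {p | p ∈ O ∧ ¬ p.1.IsAssertion}

/-- freshness and distinctness of the names C_a, C_{ran(R)}, R_{ab} -/
def TFresh (O : Ont C R Iv V) (cA : Iv → C) (cRan : R → C) (rab : Iv → Iv → R) : Prop :=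
  (∀ a, cA a ∉ Ont.cnames O) ∧ (∀ r, cRan r ∉ Ont.cnames O) ∧
  (∀ a b, rab a b ∉ Ont.rnames O) ∧
  Function.Injective cA ∧ Function.Injective cRan ∧
  (∀ a r, cA a ≠ cRan r) ∧
  (∀ a b a' b', rab a b = rab a' b' → a = a' ∧ b = b')

/-- a directed path of role assertions from x to y in O -/
def Reach (O : Ont C R Iv V) (x y : Iv) : Prop :=
  Relation.ReflTransGen (fun u w => ∃ r v, (Ax.ra r u w, v) ∈ O) x y

end Prov

namespace Prov

variable {C R Iv V : Type} [DecidableEq V]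

/-- Domain of the canonical model: named elements, the element `ε`, and a witness for every role name
and every annotation of an edge leading to it. -/
inductive CanonElem (R Iv V : Type) : Type
  | ind : Iv → CanonElem R Iv V
  | eps : CanonElem R Iv V
  | wit : R → Monomial V → CanonElem R Iv V

namespace CanonElem

/-- The concept expression whose consequences hold at a canonical element. -/
def seed {Δ Δm : Type} (cA : Iv → C) (J : Interp C R Iv V Δ Δm) :
    CanonElem R Iv V → Set (Δ × Δm)
  | ind a => J.conI (cA a)
  | eps => J.cInt Concept.top
  | wit r _ => J.ranI r

/-- The annotation with which `seed` holds at a canonical element. -/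
def seedMon : CanonElem R Iv V → Monomial V
  | ind _ => ∅
  | eps => ∅
  | wit _ m => m

end CanonElem

/-- `T` entails that every instance of `seed x` is an instance of `c`, with annotation `k`. -/
def SeedEntails (T : Ont C R Iv V) (cA : Iv → C) (x : CanonElem R Iv V) (c : Concept C R)
    (k : Monomial V) : Prop :=
  ∀ (Δ Δm : Type) (J : Interp C R Iv V Δ Δm), J.IsModel T →
    ∀ d n, (d, J.monI n) ∈ x.seed cA J → (d, J.monI (k ∪ n)) ∈ J.cInt c

/-- The concept memberships of a canonical element: consequences of `⊤` and of its seed. -/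
def Holds (T : Ont C R Iv V) (cA : Iv → C) (x : CanonElem R Iv V) (c : Concept C R)
    (m : Monomial V) : Prop :=
  Entails T (Ax.gci Concept.top c) m ∨ ∃ k, m = x.seedMon ∪ k ∧ SeedEntails T cA x c k

/-- Role memberships between individuals obtained from assertions by closing under the role
inclusions of `O`. -/
inductive NamedEdge (O : Ont C R Iv V) (a b : Iv) : R → Monomial V → Prop
  | base {r v} : (Ax.ra r a b, v) ∈ O → NamedEdge O a b r v
  | step {r s m v} : NamedEdge O a b r m → (Ax.ri r s, v) ∈ O → NamedEdge O a b s (v ∪ m)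

/-- The role memberships of the canonical model, for role names other than the `R_{ab}`. -/
inductive CanonEdge (O T : Ont C R Iv V) (cA : Iv → C) :
    CanonElem R Iv V → CanonElem R Iv V → R → Monomial V → Prop
  | named {a b s m} : NamedEdge O a b s m → CanonEdge O T cA (.ind a) (.ind b) s m
  | wit {x r s m k} : Holds T cA x (Concept.ex r Concept.top) m → Entails T (Ax.ri r s) k →
      CanonEdge O T cA x (.wit r m) s (k ∪ m)

open Classical in
/-- The canonical model of `T`. -/
noncomputable def canon (O T : Ont C R Iv V) (a₀ : Iv) (cA : Iv → C) (rab : Iv → Iv → R) :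
    Interp C R Iv V (CanonElem R Iv V) (Monomial V) where
  indI a := if Reach O a₀ a then .ind a else .eps
  conI A := {p | (∃ c, A = cA c ∧ Reach O a₀ c ∧ p = (.ind c, ∅)) ∨
    ((∀ c, A ≠ cA c) ∧ Holds T cA p.1 (Concept.atom A) p.2)}
  rolI s := {p | (∃ a b, s = rab a b ∧ Reach O a₀ a ∧ (∃ r v, (Ax.ra r a b, v) ∈ O) ∧
      p = (.ind a, .ind b, ∅)) ∨
    ((∀ a b, s ≠ rab a b) ∧ CanonEdge O T cA p.1 p.2.1 s p.2.2)}
  monI := id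
  monI_inj := Function.injective_id
  neD := ⟨.eps⟩
  neDm := ⟨∅⟩

section Interp

variable {Δ Δm : Type} {J : Interp C R Iv V Δ Δm}

theorem Interp.mem_top {d : Δ} {n : Monomial V} :
    (d, J.monI n) ∈ J.cInt Concept.top ↔ n = ∅ :=
  J.monI_inj.eq_iff

theorem Interp.mem_conj {d : Δ} {m n : Monomial V} {c c' : Concept C R}
    (h : (d, J.monI m) ∈ J.cInt c) (h' : (d, J.monI n) ∈ J.cInt c') :
    (d, J.monI (m ∪ n)) ∈ J.cInt (Concept.conj c c') :=
  ⟨d, m, n, h, h', rfl⟩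

theorem Interp.mem_ex {d e : Δ} {m n : Monomial V} {r : R} {c : Concept C R}
    (h : (d, e, J.monI m) ∈ J.rolI r) (h' : (e, J.monI n) ∈ J.cInt c) :
    (d, J.monI (m ∪ n)) ∈ J.cInt (Concept.ex r c) :=
  ⟨d, e, m, n, h, h', rfl⟩

theorem Interp.exists_of_mem_ex_top {d : Δ} {m : Monomial V} {r : R}
    (h : (d, J.monI m) ∈ J.cInt (Concept.ex r Concept.top)) :
    ∃ e, (d, e, J.monI m) ∈ J.rolI r := by
  obtain ⟨x, e, k, n, hr, ht, hp⟩ := h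
  obtain ⟨rfl, hm⟩ := Prod.mk.inj hp
  obtain rfl := Interp.mem_top.1 ht
  rw [Finset.union_empty] at hm
  exact ⟨e, hm ▸ hr⟩

end Interp

theorem Entails.of_mem {T : Ont C R Iv V} {α : Ax C R Iv} {v : Monomial V} (h : (α, v) ∈ T) :
    Entails T α v :=
  fun _ _ _ hJ => hJ _ h

theorem Entails.gci_top {T : Ont C R Iv V} {c : Concept C R} {m : Monomial V}
    (h : Entails T (Ax.gci Concept.top c) m) {Δ Δm : Type} {J : Interp C R Iv V Δ Δm}
    (hJ : J.IsModel T) (d : Δ) : (d, J.monI m) ∈ J.cInt c := by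
  simpa using h _ _ J hJ d ∅ rfl

theorem entails_gci_top {T : Ont C R Iv V} {c : Concept C R} {m : Monomial V}
    (h : ∀ (Δ Δm : Type) (J : Interp C R Iv V Δ Δm), J.IsModel T →
      ∀ d, (d, J.monI m) ∈ J.cInt c) : Entails T (Ax.gci Concept.top c) m := by
  intro Δ Δm J hJ d n hn
  obtain rfl := Interp.mem_top.1 hn
  simpa using h _ _ J hJ d

theorem Entails.ri_refl {T : Ont C R Iv V} (r : R) : Entails T (Ax.ri r r) ∅ := by
  intro Δ Δm J _ x y n h
  simpa using h

theorem Entails.ri_trans {T : Ont C R Iv V} {r s t : R} {m n : Monomial V}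
    (h : Entails T (Ax.ri r s) m) (h' : Entails T (Ax.ri s t) n) :
    Entails T (Ax.ri r t) (n ∪ m) := by
  intro Δ Δm J hJ x y k hk
  rw [Finset.union_assoc]
  exact h' _ _ J hJ _ _ _ (h _ _ J hJ _ _ _ hk)

theorem Entails.gci_trans {T : Ont C R Iv V} {c d e : Concept C R} {m n : Monomial V}
    (h : Entails T (Ax.gci c d) m) (h' : Entails T (Ax.gci d e) n) :
    Entails T (Ax.gci c e) (n ∪ m) := by
  intro Δ Δm J hJ x k hk
  rw [Finset.union_assoc]
  exact h' _ _ J hJ _ _ (h _ _ J hJ _ _ hk)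

section Holds

variable {T : Ont C R Iv V} {cA : Iv → C} {x : CanonElem R Iv V}

theorem Holds.top : Holds T cA x Concept.top ∅ :=
  Or.inl (entails_gci_top fun _ _ _ _ _ => rfl)

theorem Holds.of_entails_ind {a : Iv} {c : Concept C R} {m : Monomial V}
    (h : Entails T (Ax.gci (Concept.atom (cA a)) c) m) : Holds T cA (.ind a) c m :=
  Or.inr ⟨m, (Finset.empty_union m).symm, h⟩

theorem Holds.gci {c d : Concept C R} {m v : Monomial V} (h : Holds T cA x c m)
    (hcd : Entails T (Ax.gci c d) v) : Holds T cA x d (v ∪ m) := by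
  rcases h with h | ⟨k, rfl, h⟩
  · exact Or.inl (h.gci_trans hcd)
  · refine Or.inr ⟨v ∪ k, Finset.union_left_comm .., fun Δ Δm J hJ e n he => ?_⟩
    rw [Finset.union_assoc]
    exact hcd _ _ J hJ _ _ (h _ _ J hJ _ _ he)

theorem Holds.conj {c d : Concept C R} {m n : Monomial V} (hc : Holds T cA x c m)
    (hd : Holds T cA x d n) : Holds T cA x (Concept.conj c d) (m ∪ n) := by
  rcases hc with hc | ⟨k, rfl, hc⟩ <;> rcases hd with hd | ⟨l, rfl, hd⟩
  · exact Or.inl (entails_gci_top fun Δ Δm J hJ e =>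
      Interp.mem_conj (hc.gci_top hJ e) (hd.gci_top hJ e))
  · refine Or.inr ⟨m ∪ l, by grind, fun Δ Δm J hJ e n he => ?_⟩
    convert Interp.mem_conj (hc.gci_top hJ e) (hd _ _ J hJ _ _ he) using 3
    grind
  · refine Or.inr ⟨k ∪ n, by grind, fun Δ Δm J hJ e n' he => ?_⟩
    convert Interp.mem_conj (hc _ _ J hJ _ _ he) (hd.gci_top hJ e) using 3
    grind
  · refine Or.inr ⟨k ∪ l, by grind, fun Δ Δm J hJ e n he => ?_⟩
    convert Interp.mem_conj (hc _ _ J hJ _ _ he) (hd _ _ J hJ _ _ he) using 3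
    grind

theorem Holds.ex_wit {r s : R} {c : Concept C R} {m n k : Monomial V}
    (h : Holds T cA x (Concept.ex r Concept.top) m) (hrs : Entails T (Ax.ri r s) k)
    (hc : Holds T cA (.wit r m) c n) : Holds T cA x (Concept.ex s c) (k ∪ m ∪ n) := by
  rcases h with h | ⟨l, rfl, h⟩ <;> rcases hc with hc | ⟨p, rfl, hc⟩
  · refine Or.inl (entails_gci_top fun Δ Δm J hJ d => ?_)
    obtain ⟨e, he⟩ := Interp.exists_of_mem_ex_top (h.gci_top hJ d)
    exact Interp.mem_ex (hrs _ _ J hJ _ _ _ he) (hc.gci_top hJ e)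
  · refine Or.inl (entails_gci_top fun Δ Δm J hJ d => ?_)
    obtain ⟨e, he⟩ := Interp.exists_of_mem_ex_top (h.gci_top hJ d)
    convert Interp.mem_ex (hrs _ _ J hJ _ _ _ he) (hc _ _ J hJ e _ ⟨d, he⟩) using 3
    grind [CanonElem.seedMon]
  · refine Or.inr ⟨k ∪ l ∪ n, by grind, fun Δ Δm J hJ d q hd => ?_⟩
    obtain ⟨e, he⟩ := Interp.exists_of_mem_ex_top (h _ _ J hJ d q hd)
    convert Interp.mem_ex (hrs _ _ J hJ _ _ _ he) (hc.gci_top hJ e) using 3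
    grind
  · refine Or.inr ⟨k ∪ l ∪ p, by grind [CanonElem.seedMon], fun Δ Δm J hJ d q hd => ?_⟩
    obtain ⟨e, he⟩ := Interp.exists_of_mem_ex_top (h _ _ J hJ d q hd)
    convert Interp.mem_ex (hrs _ _ J hJ _ _ _ he) (hc _ _ J hJ e _ ⟨d, he⟩) using 3
    grind

theorem Holds.rr_wit {r s : R} {A : C} {m k v : Monomial V} (hrs : Entails T (Ax.ri r s) k)
    (hA : Entails T (Ax.rr s A) v) :
    Holds T cA (.wit r m) (Concept.atom A) (v ∪ (k ∪ m)) := by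
  refine Or.inr ⟨v ∪ k, by grind [CanonElem.seedMon], fun Δ Δm J hJ e n he => ?_⟩
  obtain ⟨d, hd⟩ := he
  rw [Finset.union_assoc]
  exact hA _ _ J hJ _ _ ⟨d, hrs _ _ J hJ _ _ _ hd⟩

end Holds

section Tont

variable {O : Ont C R Iv V} {cA : Iv → C} {cRan : R → C} {rab : Iv → Iv → R}

theorem mem_inds_left {r : R} {a b : Iv} {v : Monomial V} (h : (Ax.ra r a b, v) ∈ O) :
    a ∈ Ont.inds O :=
  ⟨_, h, Or.inl rfl⟩

theorem mem_inds_right {r : R} {a b : Iv} {v : Monomial V} (h : (Ax.ra r a b, v) ∈ O) :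
    b ∈ Ont.inds O :=
  ⟨_, h, Or.inr rfl⟩

theorem entails_of_not_isAssertion {α : Ax C R Iv} {v : Monomial V} (h : (α, v) ∈ O)
    (hα : ¬ α.IsAssertion) : Entails (Tont O cA cRan rab) α v :=
  Entails.of_mem (Or.inr ⟨h, hα⟩)

theorem entails_cA_of_ca {a : Iv} {A : C} {v : Monomial V}
    (h : (Ax.ca (Concept.atom A) a, v) ∈ O) :
    Entails (Tont O cA cRan rab) (Ax.gci (Concept.atom (cA a)) (Concept.atom A)) v :=
  Entails.of_mem (Or.inl (Or.inl (Or.inl (Or.inl (Or.inl ⟨a, A, v, ⟨_, h, rfl⟩, h, rfl⟩)))))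

theorem entails_cA_ex_rab {r : R} {a b : Iv} {v : Monomial V} (h : (Ax.ra r a b, v) ∈ O) :
    Entails (Tont O cA cRan rab)
      (Ax.gci (Concept.atom (cA a)) (Concept.ex (rab a b) Concept.top)) ∅ :=
  Entails.of_mem (Or.inl (Or.inl (Or.inl (Or.inl (Or.inr
    ⟨a, b, r, v, mem_inds_left h, h, Or.inl rfl⟩)))))

theorem entails_ri_rab {r : R} {a b : Iv} {v : Monomial V} (h : (Ax.ra r a b, v) ∈ O) :
    Entails (Tont O cA cRan rab) (Ax.ri (rab a b) r) v :=
  Entails.of_mem (Or.inl (Or.inl (Or.inl (Or.inl (Or.inr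
    ⟨a, b, r, v, mem_inds_left h, h, Or.inr (Or.inl rfl)⟩)))))

theorem entails_rr_rab {r : R} {a b : Iv} {v : Monomial V} (h : (Ax.ra r a b, v) ∈ O) :
    Entails (Tont O cA cRan rab) (Ax.rr (rab a b) (cA b)) ∅ :=
  Entails.of_mem (Or.inl (Or.inl (Or.inl (Or.inl (Or.inr
    ⟨a, b, r, v, mem_inds_left h, h, Or.inr (Or.inr rfl)⟩)))))

theorem entails_cA_cRan {r : R} {a b : Iv} {v : Monomial V} (h : (Ax.ra r a b, v) ∈ O) :
    Entails (Tont O cA cRan rab) (Ax.gci (Concept.atom (cA b)) (Concept.atom (cRan r))) v :=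
  Entails.of_mem (Or.inl (Or.inl (Or.inl (Or.inr ⟨b, a, r, v, mem_inds_right h, h, rfl⟩))))

theorem entails_cRan_cRan {r s : R} {a : Iv} {v : Monomial V} (ha : a ∈ Ont.inds O)
    (h : (Ax.ri r s, v) ∈ O) :
    Entails (Tont O cA cRan rab) (Ax.gci (Concept.atom (cRan r)) (Concept.atom (cRan s))) v :=
  Entails.of_mem (Or.inl (Or.inl (Or.inr ⟨a, r, s, v, ha, h, rfl⟩)))

theorem entails_cRan_of_rr {r : R} {A : C} {a : Iv} {v : Monomial V} (ha : a ∈ Ont.inds O)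
    (h : (Ax.rr r A, v) ∈ O) :
    Entails (Tont O cA cRan rab) (Ax.gci (Concept.atom (cRan r)) (Concept.atom A)) v :=
  Entails.of_mem (Or.inl (Or.inr ⟨a, r, A, v, ha, h, rfl⟩))

theorem NamedEdge.exists_ra {a b : Iv} {s : R} {m : Monomial V} (h : NamedEdge O a b s m) :
    ∃ r v, (Ax.ra r a b, v) ∈ O := by
  induction h with
  | base h => exact ⟨_, _, h⟩
  | step _ _ ih => exact ih

theorem NamedEdge.entails_ri {a b : Iv} {s : R} {m : Monomial V} (h : NamedEdge O a b s m) :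
    Entails (Tont O cA cRan rab) (Ax.ri (rab a b) s) m := by
  induction h with
  | base h => exact entails_ri_rab h
  | step _ h ih => exact ih.ri_trans (entails_of_not_isAssertion h id)

theorem NamedEdge.entails_cRan {a b : Iv} {s : R} {m : Monomial V} (h : NamedEdge O a b s m) :
    Entails (Tont O cA cRan rab) (Ax.gci (Concept.atom (cA b)) (Concept.atom (cRan s))) m := by
  induction h with
  | base h => exact entails_cA_cRan h
  | step h₁ h ih =>
    obtain ⟨r, v, h₀⟩ := h₁.exists_ra
    exact ih.gci_trans (entails_cRan_cRan (mem_inds_right h₀) h)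

theorem NamedEdge.holds_ex {a b : Iv} {s : R} {c : Concept C R} {m n : Monomial V}
    (h : NamedEdge O a b s m) (hc : Holds (Tont O cA cRan rab) cA (.ind b) c n) :
    Holds (Tont O cA cRan rab) cA (.ind a) (Concept.ex s c) (m ∪ n) := by
  obtain ⟨r, v, h₀⟩ := h.exists_ra
  refine Holds.of_entails_ind fun Δ Δm J hJ d q hd => ?_
  obtain ⟨e, he⟩ := Interp.exists_of_mem_ex_top (entails_cA_ex_rab h₀ _ _ J hJ _ _ hd)
  rw [Finset.empty_union] at he
  have hs := h.entails_ri _ _ J hJ _ _ _ he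
  have hb := entails_rr_rab h₀ _ _ J hJ e q ⟨d, he⟩
  rw [Finset.empty_union] at hb
  rcases hc with hc | ⟨k, rfl, hc⟩
  · convert Interp.mem_ex hs (hc.gci_top hJ e) using 3
    grind
  · convert Interp.mem_ex hs (hc _ _ J hJ _ _ hb) using 3
    grind [CanonElem.seedMon]

theorem CanonEdge.holds_ex {x y : CanonElem R Iv V} {s : R} {c : Concept C R}
    {m n : Monomial V} (h : CanonEdge O (Tont O cA cRan rab) cA x y s m)
    (hc : Holds (Tont O cA cRan rab) cA y c n) :
    Holds (Tont O cA cRan rab) cA x (Concept.ex s c) (m ∪ n) := by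
  cases h with
  | named h => exact h.holds_ex hc
  | wit h hrs => exact h.ex_wit hrs hc

theorem CanonEdge.ri {x y : CanonElem R Iv V} {s t : R} {m v : Monomial V}
    (h : CanonEdge O (Tont O cA cRan rab) cA x y s m) (hst : (Ax.ri s t, v) ∈ O) :
    CanonEdge O (Tont O cA cRan rab) cA x y t (v ∪ m) := by
  cases h with
  | named h => exact .named (h.step hst)
  | wit h hrs =>
    rw [← Finset.union_assoc]
    exact .wit h (hrs.ri_trans (entails_of_not_isAssertion hst id))

theorem CanonEdge.rr {x y : CanonElem R Iv V} {s : R} {A : C} {m v : Monomial V}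
    (h : CanonEdge O (Tont O cA cRan rab) cA x y s m) (hA : (Ax.rr s A, v) ∈ O) :
    Holds (Tont O cA cRan rab) cA y (Concept.atom A) (v ∪ m) := by
  cases h with
  | named h =>
    obtain ⟨r, w, h₀⟩ := h.exists_ra
    exact .of_entails_ind (h.entails_cRan.gci_trans (entails_cRan_of_rr (mem_inds_right h₀) hA))
  | wit h hrs => exact .rr_wit hrs (entails_of_not_isAssertion hA id)

end Tont

section Canon

variable {O T : Ont C R Iv V} {a₀ : Iv} {cA : Iv → C} {cRan : R → C} {rab : Iv → Iv → R}

theorem mem_canon_cA {c : Iv} {p : CanonElem R Iv V × Monomial V} (hcA : Function.Injective cA) :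
    p ∈ (canon O T a₀ cA rab).conI (cA c) ↔ Reach O a₀ c ∧ p = (.ind c, ∅) := by
  constructor
  · rintro (⟨d, hd, h⟩ | ⟨h, -⟩)
    · exact hcA hd ▸ h
    · exact absurd rfl (h c)
  · exact fun h => Or.inl ⟨c, rfl, h⟩

theorem mem_canon_conI {A : C} {x : CanonElem R Iv V} {m : Monomial V} (hA : ∀ c, A ≠ cA c) :
    (x, m) ∈ (canon O T a₀ cA rab).conI A ↔ Holds T cA x (Concept.atom A) m := by
  constructor
  · rintro (⟨c, hc, -⟩ | ⟨-, h⟩)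
    · exact absurd hc (hA c)
    · exact h
  · exact fun h => Or.inr ⟨hA, h⟩

theorem mem_canon_rab {a b : Iv} {p : CanonElem R Iv V × CanonElem R Iv V × Monomial V}
    (hrab : ∀ a b a' b', rab a b = rab a' b' → a = a' ∧ b = b') :
    p ∈ (canon O T a₀ cA rab).rolI (rab a b) ↔
      Reach O a₀ a ∧ (∃ r v, (Ax.ra r a b, v) ∈ O) ∧ p = (.ind a, .ind b, ∅) := by
  constructor
  · rintro (⟨a', b', hab, h⟩ | ⟨h, -⟩)
    · obtain ⟨rfl, rfl⟩ := hrab _ _ _ _ hab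
      exact h
    · exact absurd rfl (h a b)
  · exact fun h => Or.inl ⟨a, b, rfl, h⟩

theorem mem_canon_rolI {s : R} {x y : CanonElem R Iv V} {m : Monomial V}
    (hs : ∀ a b, s ≠ rab a b) :
    (x, y, m) ∈ (canon O T a₀ cA rab).rolI s ↔ CanonEdge O T cA x y s m := by
  constructor
  · rintro (⟨a, b, hab, -⟩ | ⟨-, h⟩)
    · exact absurd hab (hs a b)
    · exact h
  · exact fun h => Or.inr ⟨hs, h⟩

theorem canon_indI_eq_eps {a : Iv} :
    (canon O T a₀ cA rab).indI a = .eps ↔ ¬ Reach O a₀ a := by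
  by_cases h : Reach O a₀ a <;> simp [canon, h]

theorem canon_indI_of_reach {a : Iv} (h : Reach O a₀ a) :
    (canon O T a₀ cA rab).indI a = .ind a :=
  if_pos h

theorem holds_of_mem_canon_of_isBasic {c : Concept C R} (hc : c.IsBasic)
    (hcA : ∀ a, cA a ∉ c.cnames) {x : CanonElem R Iv V} {m : Monomial V}
    (h : (x, m) ∈ (canon O T a₀ cA rab).cInt c) : Holds T cA x c m := by
  cases c with
  | top =>
    obtain rfl : m = ∅ := h
    exact Holds.top
  | atom A => exact (mem_canon_conI fun a ha => hcA a ha.symm).1 h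
  | conj => exact hc.elim
  | ex => exact hc.elim

theorem mem_canon_ex_top {s : R} {x : CanonElem R Iv V} {m : Monomial V}
    (hs : ∀ a b, s ≠ rab a b) (h : Holds T cA x (Concept.ex s Concept.top) m) :
    (x, m) ∈ (canon O T a₀ cA rab).cInt (Concept.ex s Concept.top) := by
  refine ⟨x, .wit s m, m, ∅, (mem_canon_rolI hs).2 ?_, rfl, by simp [canon]⟩
  simpa [canon] using CanonEdge.wit (O := O) h (Entails.ri_refl s)

theorem canon_sat_gci {c d : Concept C R} {v : Monomial V} (h : (Ax.gci c d, v) ∈ O)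
    (hnf : (Ax.gci c d : Ax C R Iv).IsNF) (hfresh : TFresh O cA cRan rab) :
    (canon O (Tont O cA cRan rab) a₀ cA rab).Sat (Ax.gci c d) v := by
  obtain ⟨hcA, -, hrab, -⟩ := hfresh
  have hcd : Entails (Tont O cA cRan rab) (Ax.gci c d) v := entails_of_not_isAssertion h id
  have hcc : ∀ a, cA a ∉ c.cnames := fun a ha => hcA a ⟨_, h, Or.inl ha⟩
  have hdc : ∀ a, cA a ∉ d.cnames := fun a ha => hcA a ⟨_, h, Or.inr ha⟩
  have hcr : ∀ a b, rab a b ∉ c.rnames := fun a b ha => hrab a b ⟨_, h, Or.inl ha⟩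
  have hdr : ∀ a b, rab a b ∉ d.rnames := fun a b ha => hrab a b ⟨_, h, Or.inr ha⟩
  intro x n hx
  change (x, n) ∈ _ at hx
  change (x, v ∪ n) ∈ _
  have hold : Holds (Tont O cA cRan rab) cA x c n := by
    rcases hnf with ⟨-, hc | ⟨c₁, c₂, rfl, h₁, h₂⟩ | ⟨r, c₁, rfl, h₁⟩⟩ | ⟨hc, -⟩
    · exact holds_of_mem_canon_of_isBasic hc hcc hx
    · obtain ⟨y, m₁, m₂, hy₁, hy₂, hp⟩ := hx
      obtain ⟨rfl, rfl⟩ := Prod.mk.inj hp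
      exact (holds_of_mem_canon_of_isBasic h₁ (fun a ha => hcc a (Or.inl ha)) hy₁).conj
        (holds_of_mem_canon_of_isBasic h₂ (fun a ha => hcc a (Or.inr ha)) hy₂)
    · obtain ⟨y, z, m₁, m₂, hyz, hz, hp⟩ := hx
      obtain ⟨rfl, rfl⟩ := Prod.mk.inj hp
      exact ((mem_canon_rolI fun a b hab => hcr a b (Or.inl hab.symm)).1 hyz).holds_ex
        (holds_of_mem_canon_of_isBasic h₁ hcc hz)
    · exact holds_of_mem_canon_of_isBasic hc hcc hx
  rcases hnf with ⟨⟨B, rfl⟩, -⟩ | ⟨-, r, rfl⟩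
  · exact (mem_canon_conI fun a ha => hdc a ha.symm).2 (hold.gci hcd)
  · exact mem_canon_ex_top (fun a b hab => hdr a b (Or.inl hab.symm)) (hold.gci hcd)

/-- A GCI from some `C_a` to a concept name other than the `C_b` holds as soon as it is entailed. -/
theorem canon_sat_cA {a : Iv} {A : C} {v : Monomial V} (hinj : Function.Injective cA)
    (hA : ∀ c, A ≠ cA c) (h : Entails T (Ax.gci (Concept.atom (cA a)) (Concept.atom A)) v) :
    (canon O T a₀ cA rab).Sat (Ax.gci (Concept.atom (cA a)) (Concept.atom A)) v := by
  intro x n hx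
  obtain ⟨-, hp⟩ := (mem_canon_cA hinj).1 hx
  obtain ⟨rfl, rfl⟩ : x = _ ∧ n = _ := Prod.mk.inj hp
  rw [Finset.union_empty]
  exact (mem_canon_conI hA).2 (.of_entails_ind h)

theorem canon_sat_atom {A B : C} {v : Monomial V} (hA : ∀ c, A ≠ cA c) (hB : ∀ c, B ≠ cA c)
    (h : Entails T (Ax.gci (Concept.atom A) (Concept.atom B)) v) :
    (canon O T a₀ cA rab).Sat (Ax.gci (Concept.atom A) (Concept.atom B)) v :=
  fun _ _ hx => (mem_canon_conI hB).2 (((mem_canon_conI hA).1 hx).gci h)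

theorem canon_isModel (hnf : ∀ p ∈ O, p.1.IsNF) (hfresh : TFresh O cA cRan rab) :
    (canon O (Tont O cA cRan rab) a₀ cA rab).IsModel (Tont O cA cRan rab) := by
  have ⟨hcA, _, hrab, hinj, _, hne, hrinj⟩ := hfresh
  rintro p (((((⟨a, A, v, ha, h, rfl⟩ | ⟨a, b, r, v, ha, h, rfl | rfl | rfl⟩) |
    ⟨a, b, r, v, ha, h, rfl⟩) | ⟨a, r, s, v, ha, h, rfl⟩) | ⟨a, r, A, v, ha, h, rfl⟩) | ⟨h, hp⟩)
  · exact canon_sat_cA hinj (fun c hc => hcA c ⟨_, h, hc.symm⟩) (entails_cA_of_ca h)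
  · intro x n hx
    obtain ⟨hr, hp⟩ := (mem_canon_cA hinj).1 hx
    obtain ⟨rfl, rfl⟩ : x = _ ∧ n = _ := Prod.mk.inj hp
    exact ⟨_, .ind b, ∅, ∅, (mem_canon_rab hrinj).2 ⟨hr, ⟨r, v, h⟩, rfl⟩, rfl, rfl⟩
  · intro x y n hxy
    obtain ⟨-, -, hp⟩ := (mem_canon_rab hrinj).1 hxy
    obtain ⟨rfl, hyn⟩ := Prod.mk.inj hp
    obtain ⟨rfl, rfl⟩ : y = _ ∧ n = _ := Prod.mk.inj hyn
    rw [Finset.union_empty]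
    exact (mem_canon_rolI fun a b hab => hrab a b ⟨_, h, hab.symm⟩).2 (.named (.base h))
  · rintro y n ⟨x, hxy⟩
    obtain ⟨hr, -, hp⟩ := (mem_canon_rab hrinj).1 hxy
    obtain ⟨rfl, hyn⟩ := Prod.mk.inj hp
    obtain ⟨rfl, rfl⟩ : y = _ ∧ n = _ := Prod.mk.inj hyn
    exact (mem_canon_cA hinj).2 ⟨hr.tail ⟨r, v, h⟩, rfl⟩
  · exact canon_sat_cA hinj (fun c => (hne c r).symm) (entails_cA_cRan h)
  · exact canon_sat_atom (fun c => (hne c r).symm) (fun c => (hne c s).symm)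
      (entails_cRan_cRan ha h)
  · exact canon_sat_atom (fun c => (hne c r).symm) (fun c hc => hcA c ⟨_, h, hc.symm⟩)
      (entails_cRan_of_rr ha h)
  · obtain ⟨α, v⟩ := p
    cases α with
    | gci c d => exact canon_sat_gci h (hnf _ h) hfresh
    | ri r s =>
      intro x y n hxy
      exact (mem_canon_rolI fun a b hab => hrab a b ⟨_, h, Or.inr hab.symm⟩).2
        (((mem_canon_rolI fun a b hab => hrab a b ⟨_, h, Or.inl hab.symm⟩).1 hxy).ri h)
    | rr r A =>
      rintro y n ⟨x, hxy⟩
      exact (mem_canon_conI fun c hc => hcA c ⟨_, h, hc.symm⟩).2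
        (((mem_canon_rolI fun a b hab => hrab a b ⟨_, h, hab.symm⟩).1 hxy).rr h)
    | ca => exact absurd trivial hp
    | ra => exact absurd trivial hp

theorem entails_of_mem_canon {a : Iv} {A : C} {m : Monomial V}
    (h : ((canon O T a₀ cA rab).indI a, m) ∈ (canon O T a₀ cA rab).conI A) :
    Entails T (Ax.gci (Concept.atom (cA a)) (Concept.atom A)) m ∨
      Entails T (Ax.gci Concept.top (Concept.atom A)) m := by
  by_cases hr : Reach O a₀ a
  · rw [canon_indI_of_reach hr] at h
    rcases h with ⟨c, rfl, -, hp⟩ | ⟨-, h | ⟨k, hk, h⟩⟩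
    · obtain ⟨hc, rfl⟩ := Prod.mk.inj hp
      obtain rfl := CanonElem.ind.inj hc
      refine Or.inl fun Δ Δm J _ x n hx => ?_
      simpa using hx
    · exact Or.inr h
    · obtain rfl : m = k := hk.trans (Finset.empty_union k)
      exact Or.inl h
  · rw [canon_indI_eq_eps.2 hr] at h
    rcases h with ⟨c, -, -, hp⟩ | ⟨-, h | ⟨k, hk, h⟩⟩
    · cases (Prod.mk.inj hp).1
    · exact Or.inr h
    · obtain rfl : m = k := hk.trans (Finset.empty_union k)
      exact Or.inr h

end Canon

/-- there is a model I of T and ε ∈ Δ^I satisfying conditions (1)–(4). -/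
theorem stmt6 (O : Ont C R Iv V) (hO : IsNFOnt O)
    (a₀ : Iv) (ha₀ : a₀ ∈ Ont.inds O)
    (cA : Iv → C) (cRan : R → C) (rab : Iv → Iv → R)
    (hfresh : TFresh O cA cRan rab) :
    ∃ (Δ Δm : Type) (I : Interp C R Iv V Δ Δm) (ε : Δ),
      I.IsModel (Tont O cA cRan rab) ∧
      -- (1)
      (∀ a : Iv, I.indI a = ε ↔ ¬ Reach O a₀ a) ∧
      -- (2)
      (∀ a ∈ Ont.inds O,
        (I.indI a ≠ ε → I.conI (cA a) = {(I.indI a, I.monI ∅)}) ∧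
        (I.indI a = ε → I.conI (cA a) = ∅)) ∧
      -- (3)
      (∀ (r : R) (a b : Iv) (v : Monomial V), (Ax.ra r a b, v) ∈ O →
        ((I.indI a ≠ ε ∧ I.indI b ≠ ε) →
            I.rolI (rab a b) = {(I.indI a, I.indI b, I.monI ∅)}) ∧
        (¬ (I.indI a ≠ ε ∧ I.indI b ≠ ε) → I.rolI (rab a b) = ∅)) ∧
      -- (4)
      (∀ a ∈ Ont.inds O, ∀ (A : C) (m : Monomial V),
        (I.indI a, I.monI m) ∈ I.conI A →
          Entails (Tont O cA cRan rab)
            (Ax.gci (Concept.atom (cA a)) (Concept.atom A)) m ∨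
          Entails (Tont O cA cRan rab) (Ax.gci Concept.top (Concept.atom A)) m) := by
  have ⟨_, _, _, hinj, _, _, hrinj⟩ := hfresh
  refine ⟨_, _, canon O (Tont O cA cRan rab) a₀ cA rab, .eps, canon_isModel hO.2 hfresh,
    fun a => canon_indI_eq_eps, fun a _ => ⟨fun h => ?_, fun h => ?_⟩,
    fun r a b v hab => ⟨fun h => ?_, fun h => ?_⟩, fun a _ A m h => entails_of_mem_canon h⟩
  · have hr : Reach O a₀ a := by rwa [Ne, canon_indI_eq_eps, not_not] at h
    ext p
    rw [mem_canon_cA hinj, canon_indI_of_reach hr]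
    exact and_iff_right hr
  · exact Set.eq_empty_of_forall_notMem fun p hp =>
      canon_indI_eq_eps.1 h ((mem_canon_cA hinj).1 hp).1
  · simp only [Ne, canon_indI_eq_eps, not_not] at h
    ext p
    rw [mem_canon_rab hrinj, canon_indI_of_reach h.1, canon_indI_of_reach h.2]
    exact ⟨fun hp => hp.2.2, fun hp => ⟨h.1, ⟨r, v, hab⟩, hp⟩⟩
  · simp only [Ne, canon_indI_eq_eps, not_not] at h
    refine Set.eq_empty_of_forall_notMem fun p hp => ?_
    have hr := ((mem_canon_rab hrinj).1 hp).1
    exact h ⟨hr, hr.tail ⟨r, v, hab⟩⟩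

end Prov
end

section
/- Let O be an annotated ELH^r ontology in normal form, k ≥ 0, and O_k the k-saturation of O. For every ELH^r axiom α (GCI, role inclusion, range restriction, or assertion) and every monomial m, if (α,[m]) ∈ O_k then O ⊨ (α,m). -/
namespace Prov

variable {C R Iv V : Type} [DecidableEq V]

/-- One instance of a completion rule CR0–CR16: `sig` supplies the signature
    conditions ("occurs in O"), `S` supplies the premises, and the conclusion
    is the derived annotated axiom.  Letters A,…,D range over N_C ∪ {⊤}. -/
inductive CRrule (sig S : Ont C R Iv V) : Ax C R Iv → Monomial V → Prop
  | cr0c {A : C} : A ∈ Ont.cnames sig →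
      CRrule sig S (Ax.gci (Concept.atom A) (Concept.atom A)) ∅
  | cr0r {r : R} : r ∈ Ont.rnames sig → CRrule sig S (Ax.ri r r) ∅
  | cr0t : Ont.hasTop sig → CRrule sig S (Ax.gci Concept.top Concept.top) ∅
  | cr1 {r₁ r₂ r₃ : R} {m₁ m₂ : Monomial V} :
      (Ax.ri r₁ r₂, m₁) ∈ S → (Ax.ri r₂ r₃, m₂) ∈ S →
      CRrule sig S (Ax.ri r₁ r₃) (m₁ ∪ m₂)
  | cr2 {r s : R} {A : C} {m₁ m₂ : Monomial V} :
      (Ax.ri r s, m₁) ∈ S → (Ax.rr s A, m₂) ∈ S →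
      CRrule sig S (Ax.rr r A) (m₁ ∪ m₂)
  | cr3 {A : Concept C R} {r s : R} {m₁ m₂ : Monomial V} : A.IsBasic →
      (Ax.gci A (Concept.ex r Concept.top), m₁) ∈ S → (Ax.ri r s, m₂) ∈ S →
      CRrule sig S (Ax.gci A (Concept.ex s Concept.top)) (m₁ ∪ m₂)
  | cr4 {A B Cc : Concept C R} {m₁ m₂ : Monomial V} :
      A.IsBasic → B.IsBasic → Cc.IsBasic →
      (Ax.gci A B, m₁) ∈ S → (Ax.gci B Cc, m₂) ∈ S →
      CRrule sig S (Ax.gci A Cc) (m₁ ∪ m₂)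
  | cr5 {A B : Concept C R} {r : R} {m₁ m₂ : Monomial V} : A.IsBasic → B.IsBasic →
      (Ax.gci A B, m₁) ∈ S → (Ax.gci B (Concept.ex r Concept.top), m₂) ∈ S →
      CRrule sig S (Ax.gci A (Concept.ex r Concept.top)) (m₁ ∪ m₂)
  | cr6 {A B₁ B₂ Cc : Concept C R} {m₁ m₂ m₃ : Monomial V} :
      A.IsBasic → B₁.IsBasic → B₂.IsBasic → Cc.IsBasic →
      (Ax.gci A B₁, m₁) ∈ S → (Ax.gci A B₂, m₂) ∈ S →
      (Ax.gci (Concept.conj B₁ B₂) Cc, m₃) ∈ S →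
      CRrule sig S (Ax.gci A Cc) (m₁ ∪ m₂ ∪ m₃)
  | cr7 {r : R} {B₁ B₂ Cc : C} {C₁ C₂ : Concept C R} {m₁ m₂ m₃ m₄ m₅ : Monomial V} :
      C₁.IsBasic → C₂.IsBasic →
      (Ax.rr r B₁, m₁) ∈ S → (Ax.rr r B₂, m₂) ∈ S →
      (Ax.gci (Concept.atom B₁) C₁, m₃) ∈ S → (Ax.gci (Concept.atom B₂) C₂, m₄) ∈ S →
      (Ax.gci (Concept.conj C₁ C₂) (Concept.atom Cc), m₅) ∈ S →
      CRrule sig S (Ax.rr r Cc) (m₁ ∪ m₂ ∪ m₃ ∪ m₄ ∪ m₅)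
  | cr8 {A B Cc : Concept C R} {m₁ m₂ : Monomial V} :
      A.IsBasic → B.IsBasic → Cc.IsBasic →
      (Ax.gci (Concept.conj A B) Cc, m₁) ∈ S → (Ax.gci Concept.top B, m₂) ∈ S →
      CRrule sig S (Ax.gci A Cc) (m₁ ∪ m₂)
  | cr9 {A Cc D : Concept C R} {s r : R} {B : C} {m₁ m₂ m₃ m₄ m₅ : Monomial V} :
      A.IsBasic → Cc.IsBasic → D.IsBasic →
      (Ax.gci A (Concept.ex s Concept.top), m₁) ∈ S → (Ax.rr s B, m₂) ∈ S →
      (Ax.gci (Concept.atom B) Cc, m₃) ∈ S → (Ax.ri s r, m₄) ∈ S →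
      (Ax.gci (Concept.ex r Cc) D, m₅) ∈ S →
      CRrule sig S (Ax.gci A D) (m₁ ∪ m₂ ∪ m₃ ∪ m₄ ∪ m₅)
  | cr10 {A B Cc : Concept C R} {r : R} {m₁ m₂ m₃ : Monomial V} :
      A.IsBasic → B.IsBasic → Cc.IsBasic →
      (Ax.gci A (Concept.ex r Concept.top), m₁) ∈ S → (Ax.gci Concept.top B, m₂) ∈ S →
      (Ax.gci (Concept.ex r B) Cc, m₃) ∈ S →
      CRrule sig S (Ax.gci A Cc) (m₁ ∪ m₂ ∪ m₃)
  | cr11 {a : Iv} : a ∈ Ont.inds sig → CRrule sig S (Ax.ca Concept.top a) ∅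
  | cr12 {r s : R} {a b : Iv} {m₁ m₂ : Monomial V} :
      (Ax.ra r a b, m₁) ∈ S → (Ax.ri r s, m₂) ∈ S →
      CRrule sig S (Ax.ra s a b) (m₁ ∪ m₂)
  | cr13 {A B : Concept C R} {a : Iv} {m₁ m₂ : Monomial V} : A.IsBasic → B.IsBasic →
      (Ax.ca A a, m₁) ∈ S → (Ax.gci A B, m₂) ∈ S →
      CRrule sig S (Ax.ca B a) (m₁ ∪ m₂)
  | cr14 {A₁ A₂ B : Concept C R} {a : Iv} {m₁ m₂ m₃ : Monomial V} :
      A₁.IsBasic → A₂.IsBasic → B.IsBasic →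
      (Ax.ca A₁ a, m₁) ∈ S → (Ax.ca A₂ a, m₂) ∈ S →
      (Ax.gci (Concept.conj A₁ A₂) B, m₃) ∈ S →
      CRrule sig S (Ax.ca B a) (m₁ ∪ m₂ ∪ m₃)
  | cr15 {r : R} {A B : Concept C R} {a b : Iv} {m₁ m₂ m₃ : Monomial V} :
      A.IsBasic → B.IsBasic →
      (Ax.ra r a b, m₁) ∈ S → (Ax.ca A b, m₂) ∈ S →
      (Ax.gci (Concept.ex r A) B, m₃) ∈ S →
      CRrule sig S (Ax.ca B a) (m₁ ∪ m₂ ∪ m₃)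
  | cr16 {r : R} {A : C} {a b : Iv} {m₁ m₂ : Monomial V} :
      (Ax.ra r a b, m₁) ∈ S → (Ax.rr r A, m₂) ∈ S →
      CRrule sig S (Ax.ca (Concept.atom A) b) (m₁ ∪ m₂)

/-- `S` contains `O` and is closed under the completion rules restricted to
    monomials with at most k variables. -/
def SatClosed (O : Ont C R Iv V) (k : ℕ) (S : Ont C R Iv V) : Prop :=
  O ⊆ S ∧ ∀ α m, CRrule O S α m → m.card ≤ k → (α, m) ∈ S

/-- the k-saturation O_k of O, the result of exhaustively applying the
    completion rules to O restricted to monomials with ≤ k variables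
    (least such closed set). -/
def kSat (O : Ont C R Iv V) (k : ℕ) : Ont C R Iv V :=
  ⋂₀ {S | SatClosed O k S}

end Prov

namespace Prov

variable {C R Iv V : Type} [DecidableEq V]

namespace Interp
variable {Δ Δm : Type} {I : Interp C R Iv V Δ Δm}

theorem mem_cInt_conj {c d : Concept C R} {x : Δ} {m n : Monomial V}
    (hc : (x, I.monI m) ∈ I.cInt c) (hd : (x, I.monI n) ∈ I.cInt d) :
    (x, I.monI (m ∪ n)) ∈ I.cInt (Concept.conj c d) :=
  ⟨x, m, n, hc, hd, rfl⟩

theorem mem_cInt_ex {r : R} {c : Concept C R} {x e : Δ} {m n : Monomial V}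
    (hr : (x, e, I.monI m) ∈ I.rolI r) (hc : (e, I.monI n) ∈ I.cInt c) :
    (x, I.monI (m ∪ n)) ∈ I.cInt (Concept.ex r c) :=
  ⟨x, e, m, n, hr, hc, rfl⟩

theorem mem_cInt_top (x : Δ) : (x, I.monI ∅) ∈ I.cInt Concept.top := rfl

theorem mem_cInt_ex_top {r : R} {x : Δ} {m : Monomial V} :
    (x, I.monI m) ∈ I.cInt (Concept.ex r Concept.top) ↔ ∃ e, (x, e, I.monI m) ∈ I.rolI r := by
  constructor
  · rintro ⟨y, e, p, q, hr, hq, h⟩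
    obtain rfl : q = ∅ := I.monI_inj hq
    obtain rfl : x = y := (Prod.mk.inj h).1
    obtain rfl : m = p := by simpa using I.monI_inj (Prod.mk.inj h).2
    exact ⟨e, hr⟩
  · rintro ⟨e, hr⟩
    simpa using mem_cInt_ex hr (mem_cInt_top e)

/-- Each completion rule preserves satisfaction in a fixed interpretation. -/
theorem sat_of_CRrule {sig : Ont C R Iv V} {α : Ax C R Iv} {m : Monomial V}
    (h : CRrule sig {p | I.Sat p.1 p.2} α m) : I.Sat α m := by
  cases h with
  | cr0c _ => intro x n hx; simpa using hx
  | cr0r _ => intro x y n hx; simpa using hx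
  | cr0t _ => intro x n hx; simpa using hx
  | cr1 h₁ h₂ =>
    intro x y n hx
    convert h₂ _ _ _ (h₁ _ _ _ hx) using 4
    grind
  | cr2 h₁ h₂ =>
    rintro x n ⟨d, hx⟩
    convert h₂ _ _ ⟨d, h₁ _ _ _ hx⟩ using 3
    grind
  | cr3 _ h₁ h₂ =>
    intro x n hx
    obtain ⟨e, he⟩ := mem_cInt_ex_top.1 (h₁ _ _ hx)
    refine mem_cInt_ex_top.2 ⟨e, ?_⟩
    convert h₂ _ _ _ he using 4
    grind
  | cr4 _ _ _ h₁ h₂ | cr5 _ _ h₁ h₂ =>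
    intro x n hx
    convert h₂ _ _ (h₁ _ _ hx) using 3
    grind
  | cr6 _ _ _ _ h₁ h₂ h₃ =>
    intro x n hx
    convert h₃ _ _ (mem_cInt_conj (h₁ _ _ hx) (h₂ _ _ hx)) using 3
    grind
  | cr7 _ _ h₁ h₂ h₃ h₄ h₅ =>
    intro x n hx
    change _ ∈ I.cInt (Concept.atom _)
    convert h₅ _ _ (mem_cInt_conj (h₃ _ _ (h₁ _ _ hx)) (h₄ _ _ (h₂ _ _ hx))) using 3
    grind
  | cr8 _ _ _ h₁ h₂ =>
    intro x n hx
    convert h₁ _ _ (mem_cInt_conj hx (h₂ _ _ (mem_cInt_top x))) using 3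
    grind
  | cr9 _ _ _ h₁ h₂ h₃ h₄ h₅ =>
    intro x n hx
    obtain ⟨e, he⟩ := mem_cInt_ex_top.1 (h₁ _ _ hx)
    convert h₅ _ _ (mem_cInt_ex (h₄ _ _ _ he) (h₃ _ _ (h₂ _ _ ⟨x, he⟩))) using 3
    grind
  | cr10 _ _ _ h₁ h₂ h₃ =>
    intro x n hx
    obtain ⟨e, he⟩ := mem_cInt_ex_top.1 (h₁ _ _ hx)
    convert h₃ _ _ (mem_cInt_ex he (h₂ _ _ (mem_cInt_top e))) using 3
    grind
  | cr11 _ => exact mem_cInt_top _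
  | cr12 h₁ h₂ => rw [Finset.union_comm]; exact h₂ _ _ _ h₁
  | cr13 _ _ h₁ h₂ => rw [Finset.union_comm]; exact h₂ _ _ h₁
  | cr14 _ _ _ h₁ h₂ h₃ =>
    rw [Finset.union_comm]; exact h₃ _ _ (mem_cInt_conj h₁ h₂)
  | cr15 _ _ h₁ h₂ h₃ =>
    rw [Finset.union_comm]; exact h₃ _ _ (mem_cInt_ex h₁ h₂)
  | cr16 h₁ h₂ => rw [Finset.union_comm]; exact h₂ _ _ ⟨_, h₁⟩

theorem IsModel.satClosed {O : Ont C R Iv V} (hI : I.IsModel O) (k : ℕ) :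
    SatClosed O k {p | I.Sat p.1 p.2} :=
  ⟨hI, fun _ _ h _ => sat_of_CRrule h⟩

end Interp

/-- soundness of the k-saturation: for every ELH^r axiom α and
    monomial m, if (α,[m]) ∈ O_k then O ⊨ (α,m). -/
theorem stmt9 (O : Ont C R Iv V) (hO : IsNFOnt O) (k : ℕ)
    (α : Ax C R Iv) (hα : α.IsELHr) (m : Monomial V)
    (h : (α, m) ∈ kSat O k) :
    Entails O α m := by
  intro Δ Δm I hI
  exact Set.mem_sInter.1 h _ (hI.satClosed k)

end Prov
end
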